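/- Let $K$ be a field, $n\geq 4$, and $b\in U=K[y_1,\ldots,y_n]$. Consider the automorphisms $\phi=(x_1-[x_3,x_4]y_1b,\ x_2-[x_3,x_4]y_2b,\ x_3,\ldots,x_n)$ and $\psi=(x_1,x_2,\ x_3+[x_1,x_2],\ x_4,\ldots,x_n)$ of $M_n$. Then the commutator $[\phi,\psi]=\phi\psi\phi^{-1}\psi^{-1}$ equals $D(y_4b)=(x_1+[x_1,x_2]y_1y_4b,\ x_2+[x_1,x_2]y_2y_4b,\ x_3,\ldots,x_n)$. -/

import Mathlib

noncomputable section

/-- The free metabelian Lie algebra of rank `n` over `K`: the quotient of the free Lie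
algebra on `n` generators by its second derived ideal. -/
abbrev FreeMetabelianLie (K : Type) [Field K] (n : ℕ) : Type :=
  FreeLieAlgebra K (Fin n) ⧸ LieAlgebra.derivedSeries K (FreeLieAlgebra K (Fin n)) 2

/-- The free generators `x₁, …, xₙ` of the free metabelian Lie algebra. -/
def xg (K : Type) [Field K] (n : ℕ) (i : Fin n) : FreeMetabelianLie K n :=
  LieSubmodule.Quotient.mk (N := LieAlgebra.derivedSeries K (FreeLieAlgebra K (Fin n)) 2)
    (FreeLieAlgebra.of K i)

/-- The group structure on Lie algebra automorphisms, with `(e * f) x = e (f x)`. -/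
instance lieAutGroup (K : Type) [CommRing K] (L : Type) [LieRing L] [LieAlgebra K L] :
    Group (L ≃ₗ⁅K⁆ L) where
  mul e f := f.trans e
  one := LieEquiv.refl
  inv := LieEquiv.symm
  mul_assoc _ _ _ := LieEquiv.ext fun _ => rfl
  one_mul _ := LieEquiv.ext fun _ => rfl
  mul_one _ := LieEquiv.ext fun _ => rfl
  inv_mul_cancel e := LieEquiv.ext fun x => e.symm_apply_apply x

/-- An automorphism of the free metabelian Lie algebra is elementary if it maps some `xᵢ` to
`α • xᵢ + f`, with `0 ≠ α ∈ K` and `f` in the subalgebra generated by the other generators,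
and fixes all other generators. -/
def IsElementaryAut (K : Type) [Field K] (n : ℕ)
    (φ : FreeMetabelianLie K n ≃ₗ⁅K⁆ FreeMetabelianLie K n) : Prop :=
  ∃ (i : Fin n) (α : K) (f : FreeMetabelianLie K n), α ≠ 0 ∧
    f ∈ LieSubalgebra.lieSpan K (FreeMetabelianLie K n) (xg K n '' {j | j ≠ i}) ∧
    φ (xg K n i) = α • xg K n i + f ∧ ∀ j : Fin n, j ≠ i → φ (xg K n j) = xg K n j

/-- A tame automorphism is one in the subgroup generated by the elementary automorphisms. -/
def IsTame (K : Type) [Field K] (n : ℕ)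
    (φ : FreeMetabelianLie K n ≃ₗ⁅K⁆ FreeMetabelianLie K n) : Prop :=
  φ ∈ Subgroup.closure {ψ | IsElementaryAut K n ψ}

/-- A Chein automorphism (one-row transformation) moves only one generator. -/
def IsCheinAut (K : Type) [Field K] (n : ℕ)
    (φ : FreeMetabelianLie K n ≃ₗ⁅K⁆ FreeMetabelianLie K n) : Prop :=
  ∃ i : Fin n, ∀ j : Fin n, j ≠ i → φ (xg K n j) = xg K n j

/-- An almost tame automorphism is one in the subgroup generated by Chein automorphisms. -/
def IsAlmostTame (K : Type) [Field K] (n : ℕ)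
    (φ : FreeMetabelianLie K n ≃ₗ⁅K⁆ FreeMetabelianLie K n) : Prop :=
  φ ∈ Subgroup.closure {ψ | IsCheinAut K n ψ}

/-- `monoSet K n k` is the set of right-normed Lie monomials of degree `k+1` in the
generators. -/
def monoSet (K : Type) [Field K] (n : ℕ) : ℕ → Set (FreeMetabelianLie K n)
  | 0 => Set.range (xg K n)
  | k + 1 => {z | ∃ u ∈ monoSet K n k, ∃ i : Fin n, z = ⁅u, xg K n i⁆}

/-- `gradePiece K n k` (for `k ≥ 1`) is the homogeneous component `L_k` of the standard
grading: the linear span of the Lie monomials of degree `k` in the generators. -/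
def gradePiece (K : Type) [Field K] (n : ℕ) (k : ℕ) : Submodule K (FreeMetabelianLie K n) :=
  Submodule.span K (monoSet K n (k - 1))

/-- The automorphism `φ = (l₁ + m₁, …, lₙ + mₙ)` (with `lᵢ` linear, `mᵢ ∈ [M,M]`) has lower
degree `≥ d`: each `φ(xᵢ)` lies in `L₁ ⊕ (⨆ k ≥ d, L_k)`. -/
def AutLdegGE (K : Type) [Field K] (n : ℕ)
    (φ : FreeMetabelianLie K n ≃ₗ⁅K⁆ FreeMetabelianLie K n) (d : ℕ) : Prop :=
  ∀ i : Fin n, φ (xg K n i) ∈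
    gradePiece K n 1 ⊔ ⨆ (k : ℕ) (_ : d ≤ k), gradePiece K n k

/-- The action of a polynomial `a ∈ U = K[y₁,…,yₙ]` on `m`; for `m ∈ [M,M]` this is the
canonical `U`-module action on the derived ideal, determined by `m ⬝ yᵢ = ⁅m, xᵢ⁆`. -/
def polyAct (K : Type) [Field K] (n : ℕ) (a : MvPolynomial (Fin n) K)
    (m : FreeMetabelianLie K n) : FreeMetabelianLie K n :=
  ∑ d ∈ a.support, a.coeff d •
    ((List.ofFn fun i : Fin n =>
      (-(LieAlgebra.ad K (FreeMetabelianLie K n) (xg K n i))) ^ (d i)).prod m)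

/-- The polynomial `a` has lower degree `≥ d`: every monomial of `a` has total degree `≥ d`. -/
def PolyLdegGE (K : Type) [Field K] (n : ℕ) (a : MvPolynomial (Fin n) K) (d : ℕ) : Prop :=
  ∀ v ∈ a.support, d ≤ ∑ i, v i

/-- An exponential automorphism: `exp (ad z) = id + ad z` for some `z ∈ [M,M]`. -/
def IsExponentialAut (K : Type) [Field K] (n : ℕ)
    (φ : FreeMetabelianLie K n ≃ₗ⁅K⁆ FreeMetabelianLie K n) : Prop :=
  ∃ z ∈ LieAlgebra.derivedSeries K (FreeMetabelianLie K n) 1,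
    ∀ m : FreeMetabelianLie K n, φ m = m + ⁅z, m⁆

end

namespace FreeMetabelianLie

variable {K : Type} [Field K] {n : ℕ}

/-- The derived ideal of the free metabelian Lie algebra, as the linear span of the brackets. -/
noncomputable def derived (K : Type) [Field K] (n : ℕ) : Submodule K (FreeMetabelianLie K n) :=
  Submodule.span K {z | ∃ u v : FreeMetabelianLie K n, z = ⁅u, v⁆}

theorem lie_mem_derived (u v : FreeMetabelianLie K n) : ⁅u, v⁆ ∈ derived K n :=
  Submodule.subset_span ⟨u, v, rfl⟩

theorem lie_lie_lie_eq_zero (a b c d : FreeMetabelianLie K n) : ⁅⁅a, b⁆, ⁅c, d⁆⁆ = 0 := by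
  obtain ⟨a, rfl⟩ := LieSubmodule.Quotient.surjective_mk' _ a
  obtain ⟨b, rfl⟩ := LieSubmodule.Quotient.surjective_mk' _ b
  obtain ⟨c, rfl⟩ := LieSubmodule.Quotient.surjective_mk' _ c
  obtain ⟨d, rfl⟩ := LieSubmodule.Quotient.surjective_mk' _ d
  simp only [LieSubmodule.Quotient.mk'_apply, ← LieSubmodule.Quotient.mk_bracket]
  rw [LieSubmodule.Quotient.mk_eq_zero']
  simp only [LieAlgebra.derivedSeriesOfIdeal_succ, LieAlgebra.derivedSeriesOfIdeal_zero]
  exact LieSubmodule.lie_mem_lie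
    (LieSubmodule.lie_mem_lie (LieSubmodule.mem_top _) (LieSubmodule.mem_top _))
    (LieSubmodule.lie_mem_lie (LieSubmodule.mem_top _) (LieSubmodule.mem_top _))

theorem lie_eq_zero_of_mem_derived {z w : FreeMetabelianLie K n}
    (hz : z ∈ derived K n) (hw : w ∈ derived K n) : ⁅z, w⁆ = 0 := by
  induction hz using Submodule.span_induction with
  | zero => simp
  | add a b _ _ iha ihb => rw [add_lie, iha, ihb, add_zero]
  | smul c a _ ih => rw [smul_lie, ih, smul_zero]
  | mem z hz =>
    obtain ⟨a, b, rfl⟩ := hz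
    induction hw using Submodule.span_induction with
    | zero => simp
    | add c d _ _ ihc ihd => rw [lie_add, ihc, ihd, add_zero]
    | smul c a _ ih => rw [lie_smul, ih, smul_zero]
    | mem w hw =>
      obtain ⟨c, d, rfl⟩ := hw
      exact lie_lie_lie_eq_zero a b c d

theorem map_mem_derived (f : FreeMetabelianLie K n →ₗ⁅K⁆ FreeMetabelianLie K n)
    {z : FreeMetabelianLie K n} (hz : z ∈ derived K n) : f z ∈ derived K n := by
  induction hz using Submodule.span_induction with
  | zero => simp
  | add a b _ _ iha ihb => rw [map_add]; exact add_mem iha ihb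
  | smul c a _ ih => rw [map_smul]; exact Submodule.smul_mem _ c ih
  | mem z hz =>
    obtain ⟨a, b, rfl⟩ := hz
    rw [LieHom.map_lie]
    exact lie_mem_derived _ _

theorem lie_right_comm_of_mem_derived {z : FreeMetabelianLie K n} (hz : z ∈ derived K n)
    (u v : FreeMetabelianLie K n) : ⁅⁅z, u⁆, v⁆ = ⁅⁅z, v⁆, u⁆ := by
  have h := lie_eq_zero_of_mem_derived hz (lie_mem_derived u v)
  rw [leibniz_lie, ← lie_skew u] at h
  exact add_neg_eq_zero.mp h

/-- Endomorphisms of the free metabelian Lie algebra agreeing on the free generators are equal. -/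
theorem hom_ext {f g : FreeMetabelianLie K n →ₗ⁅K⁆ FreeMetabelianLie K n}
    (h : ∀ j, f (xg K n j) = g (xg K n j)) : f = g := by
  let π : FreeLieAlgebra K (Fin n) →ₗ⁅K⁆ FreeMetabelianLie K n :=
    { (LieSubmodule.Quotient.mk' (LieAlgebra.derivedSeries K (FreeLieAlgebra K (Fin n)) 2) :
        FreeLieAlgebra K (Fin n) →ₗ[K] FreeMetabelianLie K n) with
      map_lie' := rfl }
  have hπ : f.comp π = g.comp π := FreeLieAlgebra.hom_ext h
  ext z
  obtain ⟨a, rfl⟩ := LieSubmodule.Quotient.surjective_mk' _ z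
  exact LieHom.congr_fun hπ a

/-- Right multiplication by the generator `xᵢ`, i.e. the action of `yᵢ`. -/
noncomputable abbrev genAct (K : Type) [Field K] (n : ℕ) (i : Fin n) :
    Module.End K (FreeMetabelianLie K n) :=
  -(LieAlgebra.ad K (FreeMetabelianLie K n) (xg K n i))

theorem genAct_apply (i : Fin n) (z : FreeMetabelianLie K n) :
    genAct K n i z = ⁅z, xg K n i⁆ := by
  simp [genAct]

theorem genAct_pow_mem_derived (i : Fin n) (k : ℕ) {z : FreeMetabelianLie K n}
    (hz : z ∈ derived K n) : (genAct K n i ^ k) z ∈ derived K n := by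
  cases k with
  | zero => simpa using hz
  | succ k =>
    rw [pow_succ', Module.End.mul_apply, genAct_apply]
    exact lie_mem_derived _ _

theorem map_genAct_pow {C : Module.End K (FreeMetabelianLie K n)}
    (hC : ∀ j, ∀ z ∈ derived K n, C ⁅z, xg K n j⁆ = ⁅C z, xg K n j⁆)
    (i : Fin n) (k : ℕ) {z : FreeMetabelianLie K n} (hz : z ∈ derived K n) :
    C ((genAct K n i ^ k) z) = (genAct K n i ^ k) (C z) := by
  induction k with
  | zero => simp
  | succ k ih =>
    rw [pow_succ', Module.End.mul_apply, Module.End.mul_apply, genAct_apply, genAct_apply,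
      hC _ _ (genAct_pow_mem_derived i k hz), ih]

/-- The action of the monomial with exponents `d`, restricted to the variables listed in `l`. -/
noncomputable def monAct (K : Type) [Field K] (n : ℕ) (d : Fin n →₀ ℕ) (l : List (Fin n)) :
    Module.End K (FreeMetabelianLie K n) :=
  (l.map fun i => genAct K n i ^ d i).prod

theorem monAct_cons (d : Fin n →₀ ℕ) (i : Fin n) (l : List (Fin n)) (z : FreeMetabelianLie K n) :
    monAct K n d (i :: l) z = (genAct K n i ^ d i) (monAct K n d l z) := by
  simp only [monAct, List.map_cons, List.prod_cons, Module.End.mul_apply]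

theorem monAct_mem_derived (d : Fin n →₀ ℕ) (l : List (Fin n)) {z : FreeMetabelianLie K n}
    (hz : z ∈ derived K n) : monAct K n d l z ∈ derived K n := by
  induction l with
  | nil => simpa [monAct] using hz
  | cons i l ih => rw [monAct_cons]; exact genAct_pow_mem_derived i _ ih

theorem map_monAct {C : Module.End K (FreeMetabelianLie K n)}
    (hC : ∀ j, ∀ z ∈ derived K n, C ⁅z, xg K n j⁆ = ⁅C z, xg K n j⁆)
    (d : Fin n →₀ ℕ) (l : List (Fin n)) {z : FreeMetabelianLie K n} (hz : z ∈ derived K n) :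
    C (monAct K n d l z) = monAct K n d l (C z) := by
  induction l with
  | nil => simp [monAct]
  | cons i l ih =>
    rw [monAct_cons, monAct_cons, map_genAct_pow hC i _ (monAct_mem_derived d l hz), ih]

theorem genAct_lie_comm (i j : Fin n) {z : FreeMetabelianLie K n} (hz : z ∈ derived K n) :
    genAct K n i ⁅z, xg K n j⁆ = ⁅genAct K n i z, xg K n j⁆ := by
  rw [genAct_apply, genAct_apply, lie_right_comm_of_mem_derived hz]

theorem monAct_single_add_of_notMem (d : Fin n →₀ ℕ) (i : Fin n) {l : List (Fin n)}
    (hi : i ∉ l) : monAct K n (Finsupp.single i 1 + d) l = monAct K n d l := by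
  unfold monAct
  congr 1
  refine List.map_congr_left fun j hj => ?_
  have hij : i ≠ j := fun h => hi (h ▸ hj)
  simp [Finsupp.single_eq_of_ne' hij]

theorem monAct_single_add (d : Fin n →₀ ℕ) (i : Fin n) {l : List (Fin n)}
    (hl : l.Nodup) (hi : i ∈ l) {z : FreeMetabelianLie K n} (hz : z ∈ derived K n) :
    monAct K n (Finsupp.single i 1 + d) l z = ⁅monAct K n d l z, xg K n i⁆ := by
  induction l with
  | nil => simp at hi
  | cons j l ih =>
    rw [List.nodup_cons] at hl
    rw [monAct_cons, monAct_cons]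
    by_cases hij : i = j
    · subst hij
      rw [monAct_single_add_of_notMem d i hl.1, Finsupp.add_apply, Finsupp.single_eq_same,
        add_comm, pow_succ', Module.End.mul_apply, genAct_apply]
    · rw [ih hl.2 ((List.mem_cons.mp hi).resolve_left hij), Finsupp.add_apply,
        Finsupp.single_eq_of_ne' hij, zero_add, ← genAct_apply, ← genAct_apply]
      exact (map_genAct_pow (fun j _ hz => genAct_lie_comm i j hz) j _
        (monAct_mem_derived d l hz)).symm

theorem polyAct_eq_sum (a : MvPolynomial (Fin n) K) (z : FreeMetabelianLie K n) :
    polyAct K n a z = ∑ d ∈ a.support, a.coeff d • monAct K n d (List.finRange n) z := by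
  simp only [polyAct, monAct, List.ofFn_eq_map]

theorem polyAct_add (a : MvPolynomial (Fin n) K) (z w : FreeMetabelianLie K n) :
    polyAct K n a (z + w) = polyAct K n a z + polyAct K n a w := by
  simp only [polyAct_eq_sum, map_add, smul_add, Finset.sum_add_distrib]

theorem polyAct_mem_derived (a : MvPolynomial (Fin n) K) {z : FreeMetabelianLie K n}
    (hz : z ∈ derived K n) : polyAct K n a z ∈ derived K n := by
  rw [polyAct_eq_sum]
  exact Submodule.sum_mem _ fun d _ => Submodule.smul_mem _ _ (monAct_mem_derived _ _ hz)

/-- A linear map commuting with the action of the variables on the derived ideal commutes with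
the action of all polynomials. -/
theorem map_polyAct {C : Module.End K (FreeMetabelianLie K n)}
    (hC : ∀ j, ∀ z ∈ derived K n, C ⁅z, xg K n j⁆ = ⁅C z, xg K n j⁆)
    (a : MvPolynomial (Fin n) K) {z : FreeMetabelianLie K n} (hz : z ∈ derived K n) :
    C (polyAct K n a z) = polyAct K n a (C z) := by
  simp only [polyAct_eq_sum, map_sum, map_smul, map_monAct hC _ _ hz]

theorem polyAct_lie (a : MvPolynomial (Fin n) K) (i : Fin n) {z : FreeMetabelianLie K n}
    (hz : z ∈ derived K n) : polyAct K n a ⁅z, xg K n i⁆ = ⁅polyAct K n a z, xg K n i⁆ := by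
  rw [← genAct_apply, ← genAct_apply]
  exact (map_polyAct (fun j _ hz => genAct_lie_comm i j hz) a hz).symm

theorem polyAct_X_mul (a : MvPolynomial (Fin n) K) (i : Fin n) {z : FreeMetabelianLie K n}
    (hz : z ∈ derived K n) :
    polyAct K n (MvPolynomial.X i * a) z = ⁅polyAct K n a z, xg K n i⁆ := by
  rw [polyAct_eq_sum, polyAct_eq_sum, MvPolynomial.support_X_mul, Finset.sum_map, ← genAct_apply,
    map_sum]
  refine Finset.sum_congr rfl fun d _ => ?_
  rw [addLeftEmbedding_apply, MvPolynomial.coeff_X_mul, map_smul, genAct_apply,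
    monAct_single_add d i (List.nodup_finRange n) (List.mem_finRange i) hz]

/-- An endomorphism inducing the identity modulo the derived ideal commutes with the action of
polynomials on the derived ideal. -/
theorem map_polyAct_of_sub_mem (f : FreeMetabelianLie K n →ₗ⁅K⁆ FreeMetabelianLie K n)
    (hf : ∀ j, f (xg K n j) - xg K n j ∈ derived K n)
    (a : MvPolynomial (Fin n) K) {z : FreeMetabelianLie K n} (hz : z ∈ derived K n) :
    f (polyAct K n a z) = polyAct K n a (f z) := by
  refine map_polyAct (C := (f : FreeMetabelianLie K n →ₗ[K] FreeMetabelianLie K n))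
    (fun j z hz => ?_) a hz
  have h := lie_eq_zero_of_mem_derived (map_mem_derived f hz) (hf j)
  rw [lie_sub, sub_eq_zero] at h
  simpa using h

/-- An endomorphism acting on `u` and `v` as `1 + ad p`, with `p` in the derived ideal, fixes
`⁅u, v⁆`. -/
theorem map_lie_eq_self (f : FreeMetabelianLie K n →ₗ⁅K⁆ FreeMetabelianLie K n)
    {p u v : FreeMetabelianLie K n} (hp : p ∈ derived K n)
    (hu : f u = u + ⁅p, u⁆) (hv : f v = v + ⁅p, v⁆) : f ⁅u, v⁆ = ⁅u, v⁆ := by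
  have h := lie_eq_zero_of_mem_derived hp (lie_mem_derived u v)
  rw [leibniz_lie] at h
  rw [LieHom.map_lie, hu, hv, lie_add, add_lie, add_lie, lie_lie_lie_eq_zero, add_zero, add_assoc,
    h, add_zero]

end FreeMetabelianLie

open FreeMetabelianLie

open MvPolynomial in
/-- **Commutator identity in the proof of Lemma 5.** For
`φ = (x₁ - [x₃,x₄]y₁b, x₂ - [x₃,x₄]y₂b, x₃, …, xₙ)` and
`ψ = (x₁, x₂, x₃ + [x₁,x₂], x₄, …, xₙ)`, one has
`[φ,ψ] = D(y₄b) = (x₁ + [x₁,x₂]y₁y₄b, x₂ + [x₁,x₂]y₂y₄b, x₃, …, xₙ)`. -/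
theorem commutator_eq_D_y4_b (K : Type) [Field K] (n : ℕ) (hn : 4 ≤ n)
    (b : MvPolynomial (Fin n) K)
    (i0 i1 i2 i3 : Fin n)
    (h0 : (i0 : ℕ) = 0) (h1 : (i1 : ℕ) = 1) (h2 : (i2 : ℕ) = 2) (h3 : (i3 : ℕ) = 3)
    (φ ψ χ : FreeMetabelianLie K n ≃ₗ⁅K⁆ FreeMetabelianLie K n)
    (hφ0 : φ (xg K n i0) = xg K n i0 - polyAct K n (X i0 * b) ⁅xg K n i2, xg K n i3⁆)
    (hφ1 : φ (xg K n i1) = xg K n i1 - polyAct K n (X i1 * b) ⁅xg K n i2, xg K n i3⁆)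
    (hφ : ∀ j : Fin n, j ≠ i0 → j ≠ i1 → φ (xg K n j) = xg K n j)
    (hψ2 : ψ (xg K n i2) = xg K n i2 + ⁅xg K n i0, xg K n i1⁆)
    (hψ : ∀ j : Fin n, j ≠ i2 → ψ (xg K n j) = xg K n j)
    (hχ0 : χ (xg K n i0) = xg K n i0 +
      polyAct K n (X i0 * X i3 * b) ⁅xg K n i0, xg K n i1⁆)
    (hχ1 : χ (xg K n i1) = xg K n i1 +
      polyAct K n (X i1 * X i3 * b) ⁅xg K n i0, xg K n i1⁆)
    (hχ : ∀ j : Fin n, j ≠ i0 → j ≠ i1 → χ (xg K n j) = xg K n j) :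
    φ * ψ * φ⁻¹ * ψ⁻¹ = χ := by
  have d20 : i2 ≠ i0 := Fin.ne_of_val_ne (by omega)
  have d21 : i2 ≠ i1 := Fin.ne_of_val_ne (by omega)
  have d30 : i3 ≠ i0 := Fin.ne_of_val_ne (by omega)
  have d31 : i3 ≠ i1 := Fin.ne_of_val_ne (by omega)
  have d32 : i3 ≠ i2 := Fin.ne_of_val_ne (by omega)
  have hm := lie_mem_derived (xg K n i0) (xg K n i1)
  have hw := lie_mem_derived (xg K n i2) (xg K n i3)
  rw [polyAct_X_mul b _ hw, sub_eq_add_neg, ← neg_lie] at hφ0 hφ1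
  rw [mul_assoc, polyAct_X_mul _ _ hm] at hχ0 hχ1
  have hφψ : ∀ j, (φ * ψ) (xg K n j) = φ (ψ (xg K n j)) := fun _ => rfl
  have hχψφ : ∀ j, (χ * ψ * φ) (xg K n j) = χ (ψ (φ (xg K n j))) := fun _ => rfl
  have hφm : φ ⁅xg K n i0, xg K n i1⁆ = ⁅xg K n i0, xg K n i1⁆ :=
    map_lie_eq_self φ.toLieHom (neg_mem (polyAct_mem_derived b hw)) hφ0 hφ1
  have hχm : χ ⁅xg K n i0, xg K n i1⁆ = ⁅xg K n i0, xg K n i1⁆ :=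
    map_lie_eq_self χ.toLieHom (polyAct_mem_derived _ hm) hχ0 hχ1
  have hψIA : ∀ j, ψ (xg K n j) - xg K n j ∈ derived K n := fun j => by
    by_cases hj : j = i2
    · rw [hj, hψ2, add_sub_cancel_left]
      exact hm
    · rw [hψ j hj, sub_self]
      exact zero_mem _
  have hχIA : ∀ j, χ (xg K n j) - xg K n j ∈ derived K n := fun j => by
    by_cases hj0 : j = i0
    · rw [hj0, hχ0, add_sub_cancel_left]
      exact lie_mem_derived _ _
    by_cases hj1 : j = i1
    · rw [hj1, hχ1, add_sub_cancel_left]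
      exact lie_mem_derived _ _
    rw [hχ j hj0 hj1, sub_self]
    exact zero_mem _
  have hψp : ψ (polyAct K n b ⁅xg K n i2, xg K n i3⁆) =
      polyAct K n b ⁅xg K n i2, xg K n i3⁆ +
        ⁅polyAct K n b ⁅xg K n i0, xg K n i1⁆, xg K n i3⁆ := by
    refine (map_polyAct_of_sub_mem ψ.toLieHom hψIA b hw).trans ?_
    rw [← polyAct_lie b i3 hm, ← polyAct_add, ← add_lie, ← hψ2]
    congr 1
    refine (LieEquiv.map_lie ψ _ _).trans ?_
    rw [hψ i3 d32]
  have hχp : χ (polyAct K n b ⁅xg K n i0, xg K n i1⁆) =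
      polyAct K n b ⁅xg K n i0, xg K n i1⁆ := by
    refine (map_polyAct_of_sub_mem χ.toLieHom hχIA b hm).trans ?_
    exact congrArg _ hχm
  have hχq : χ (polyAct K n b ⁅xg K n i2, xg K n i3⁆) =
      polyAct K n b ⁅xg K n i2, xg K n i3⁆ := by
    refine (map_polyAct_of_sub_mem χ.toLieHom hχIA b hw).trans ?_
    refine congrArg _ ((LieEquiv.map_lie χ _ _).trans ?_)
    rw [hχ i2 d20 d21, hχ i3 d30 d31]
  have moved : ∀ j, j ≠ i2 →
      φ (xg K n j) = xg K n j + ⁅-polyAct K n b ⁅xg K n i2, xg K n i3⁆, xg K n j⁆ →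
      χ (xg K n j) = xg K n j +
        ⁅polyAct K n (X i3 * b) ⁅xg K n i0, xg K n i1⁆, xg K n j⁆ →
      (φ * ψ) (xg K n j) = (χ * ψ * φ) (xg K n j) := by
    intro j hj2 hφj hχj
    have hlie : χ ⁅polyAct K n b ⁅xg K n i0, xg K n i1⁆, xg K n i3⁆ =
        ⁅polyAct K n b ⁅xg K n i0, xg K n i1⁆, xg K n i3⁆ := by
      rw [LieEquiv.map_lie, hχp, hχ i3 d30 d31]
    have hχz : ∀ z ∈ derived K n, χ ⁅z, xg K n j⁆ = ⁅χ z, xg K n j⁆ := fun z hz => by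
      have h := lie_eq_zero_of_mem_derived (map_mem_derived χ.toLieHom hz) (hχIA j)
      rw [lie_sub, sub_eq_zero] at h
      exact (LieEquiv.map_lie χ _ _).trans h
    rw [hφψ, hχψφ, hψ j hj2, hφj, map_add, LieEquiv.map_lie, map_neg, hψp, hψ j hj2, map_add,
      hχz _ (neg_mem (add_mem (polyAct_mem_derived b hw) (lie_mem_derived _ _))), map_neg,
      map_add, hlie, hχq, hχj, polyAct_X_mul b i3 hm]
    simp only [neg_lie, add_lie]
    abel
  have key : φ * ψ = χ * ψ * φ := by
    have h : (φ * ψ).toLieHom = (χ * ψ * φ).toLieHom := by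
      refine hom_ext fun j => ?_
      change (φ * ψ) (xg K n j) = (χ * ψ * φ) (xg K n j)
      by_cases hj0 : j = i0
      · subst hj0
        exact moved j d20.symm hφ0 hχ0
      by_cases hj1 : j = i1
      · subst hj1
        exact moved j d21.symm hφ1 hχ1
      by_cases hj2 : j = i2
      · rw [hφψ, hχψφ, hφ j hj0 hj1, hj2, hψ2, map_add, map_add, hφm, hχm, hφ i2 d20 d21,
          hχ i2 d20 d21]
      · rw [hφψ, hχψφ, hφ j hj0 hj1, hψ j hj2, hφ j hj0 hj1, hχ j hj0 hj1]
    exact LieEquiv.ext fun z => LieHom.congr_fun h z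
  rw [key]
  group
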